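/- Let X and Z be Polish spaces and let c : X × Z → ℝ≥0 be a measurable ground cost. Let Λ be a measurable space with probability measures P and Q, and let λ ↦ μ_λ (probability measures on X) and λ ↦ ν_λ (probability measures on Z) be measurable families of probability measures such that (λ, λ′) ↦ W_c(μ_λ, ν_{λ′}) is measurable. Then the optimal transport cost between the mixtures is bounded by the average of the pairwise optimal transport costs: W_c(∫ μ_λ dP(λ), ∫ ν_{λ′} dQ(λ′)) ≤ ∫∫ W_c(μ_λ, ν_{λ′}) dP(λ) dQ(λ′). -/

import Mathlib

open MeasureTheory
open scoped ENNReal NNReal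

/-- A coupling of `(μ, ν)` is a measure on the product space whose first marginal is `μ`
and second marginal is `ν`. -/
def IsCoupling {X Z : Type*} [MeasurableSpace X] [MeasurableSpace Z]
    (π : Measure (X × Z)) (μ : Measure X) (ν : Measure Z) : Prop :=
  π.map Prod.fst = μ ∧ π.map Prod.snd = ν

/-- The optimal transport cost `W_c(μ, ν)`: infimum, over probability measures `π` on the
product space whose marginals are `μ` and `ν`, of `∫ c dπ` (infimum taken in `[0, ∞]`). -/
noncomputable def OTCost {X Z : Type*} [MeasurableSpace X] [MeasurableSpace Z]
    (c : X × Z → ℝ≥0) (μ : Measure X) (ν : Measure Z) : ℝ≥0∞ :=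
  ⨅ π ∈ {π : Measure (X × Z) | IsProbabilityMeasure π ∧ IsCoupling π μ ν},
    ∫⁻ p, (c p : ℝ≥0∞) ∂π

section MeasurableSelection

open Set Filter Topology ProbabilityTheory

theorem isCompact_setOf_forall_le (n : ℕ → ℕ) : IsCompact {x : ℕ → ℕ | ∀ i, x i ≤ n i} := by
  have := isCompact_univ_pi fun i => (finite_Iic (n i)).isCompact
  simpa [Set.pi] using this

/-- A decreasing sequence of subsets of the Baire space obtained by bounding more and more
coordinates is eventually contained in any open neighbourhood of its (compact) intersection. -/
theorem exists_boundedPrefix_subset_of_isOpen (n : ℕ → ℕ) {O : Set (ℕ → ℕ)} (hO : IsOpen O)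
    (hn : {x | ∀ i, x i ≤ n i} ⊆ O) : ∃ k, {x : ℕ → ℕ | ∀ i < k, x i ≤ n i} ⊆ O := by
  by_contra! H
  simp only [not_subset] at H
  choose x hx hxO using H
  have hK := isCompact_setOf_forall_le n
  obtain ⟨y, hy, φ, hφ, hlim⟩ :=
    hK.tendsto_subseq (x := fun k i => min (x k i) (n i)) fun k i => min_le_right _ _
  have hxlim : Tendsto (fun k => x (φ k)) atTop (𝓝 y) := by
    rw [tendsto_pi_nhds] at hlim ⊢
    intro i
    refine (hlim i).congr' ?_
    filter_upwards [eventually_gt_atTop i] with k hk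
    exact min_eq_left (hx (φ k) i (hk.trans_le (hφ.id_le k)))
  obtain ⟨k, hk⟩ := (hxlim.eventually (hO.mem_nhds (hn hy))).exists
  exact hxO _ hk

theorem iInter_closure_image_boundedPrefix_subset {S : Type*} [TopologicalSpace S] [T2Space S]
    {F : (ℕ → ℕ) → S} (hF : Continuous F) (n : ℕ → ℕ) :
    ⋂ k, closure (F '' {x | ∀ i < k, x i ≤ n i}) ⊆ F '' {x | ∀ i, x i ≤ n i} := by
  intro s hs
  by_contra hsK
  have hK := isCompact_setOf_forall_le n
  obtain ⟨U, V, hU, hV, hKU, hsV, hUV⟩ :=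
    SeparatedNhds.of_isCompact_isCompact (hK.image hF) (isCompact_singleton (x := s))
      (disjoint_singleton_right.2 hsK)
  obtain ⟨k, hk⟩ := exists_boundedPrefix_subset_of_isOpen n (hU.preimage hF)
    (image_subset_iff.1 hKU)
  obtain ⟨_, hzV, hz⟩ :=
    mem_closure_iff.1 (mem_iInter.1 hs k) V hV (hsV rfl)
  exact hUV.le_bot ⟨image_subset_iff.2 hk hz, hzV⟩

/-- Inner approximation of analytic sets by compact sets, for the pullback of a finite measure. -/
theorem exists_isCompact_measure_compl_preimage_image_le {Ω S : Type*} [MeasurableSpace Ω]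
    [TopologicalSpace S] [T2Space S] [MeasurableSpace S] [OpensMeasurableSpace S]
    {F : (ℕ → ℕ) → S} (hF : Continuous F) {T : Ω → S} (hT : Measurable T)
    (hTF : range T ⊆ range F) (ρ : Measure Ω) [IsFiniteMeasure ρ] {ε : ℝ≥0∞} (hε : ε ≠ 0) :
    ∃ K : Set (ℕ → ℕ), IsCompact K ∧ ρ (T ⁻¹' (F '' K))ᶜ ≤ ε := by
  rcases eq_or_ne (ρ univ) 0 with h0 | h0
  · exact ⟨∅, isCompact_empty, by simp [h0]⟩
  have hstep : ∀ (D : Set (ℕ → ℕ)) (k : ℕ), ∃ m, ρ univ - ε < ρ (T ⁻¹' (F '' D)) →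
      ρ univ - ε < ρ (T ⁻¹' (F '' (D ∩ {x | x k ≤ m}))) := by
    intro D k
    by_cases h : ρ univ - ε < ρ (T ⁻¹' (F '' D))
    swap
    · exact ⟨0, fun h' => absurd h' h⟩
    have hU : T ⁻¹' (F '' D) = ⋃ m, T ⁻¹' (F '' (D ∩ {x | x k ≤ m})) := by
      rw [← preimage_iUnion, ← image_iUnion, ← inter_iUnion]
      congr 2
      refine (inter_eq_left.2 fun x _ => mem_iUnion.2 ⟨x k, ?_⟩).symm
      exact le_refl (x k)
    have hmono : Monotone fun m => T ⁻¹' (F '' (D ∩ {x | x k ≤ m})) := fun a b hab =>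
      preimage_mono (image_mono (inter_subset_inter_right _ fun x hx => le_trans hx hab))
    have h' := h
    rw [hU, hmono.measure_iUnion] at h'
    obtain ⟨m, hm⟩ := lt_iSup_iff.1 h'
    exact ⟨m, fun _ => hm⟩
  choose m hm using hstep
  let D : ℕ → Set (ℕ → ℕ) := fun k => Nat.rec univ (fun k E => E ∩ {x | x k ≤ m E k}) k
  have hDs : ∀ k, D (k + 1) = D k ∩ {x | x k ≤ m (D k) k} := fun _ => rfl
  have hDlt : ∀ k, ρ univ - ε < ρ (T ⁻¹' (F '' D k)) := by
    intro k
    induction k with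
    | zero =>
      have : T ⁻¹' (F '' D 0) = univ := by
        simpa [D, eq_univ_iff_forall] using fun ω => hTF (mem_range_self ω)
      rw [this]
      exact ENNReal.sub_lt_self (measure_ne_top _ _) h0 hε
    | succ k ih => exact hm _ _ ih
  let n : ℕ → ℕ := fun k => m (D k) k
  have hDn : ∀ k, D k = {x | ∀ i < k, x i ≤ n i} := by
    intro k
    induction k with
    | zero => simp [D]
    | succ k ih =>
      rw [hDs, ih]
      ext x
      simp only [mem_inter_iff, mem_ofPred_eq, Nat.lt_succ_iff_lt_or_eq, or_imp, forall_and,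
        forall_eq, n, ih]
  refine ⟨{x | ∀ i, x i ≤ n i}, isCompact_setOf_forall_le n, ?_⟩
  have hanti : Antitone fun k => T ⁻¹' closure (F '' {x | ∀ i < k, x i ≤ n i}) := fun a b hab =>
    preimage_mono (closure_mono (image_mono fun x hx i hi => hx i (hi.trans_le hab)))
  have hmeas : ∀ k, MeasurableSet (T ⁻¹' closure (F '' {x | ∀ i < k, x i ≤ n i})) := fun k =>
    hT isClosed_closure.measurableSet
  have hsub : ⋂ k, T ⁻¹' closure (F '' {x | ∀ i < k, x i ≤ n i}) ⊆
      T ⁻¹' (F '' {x | ∀ i, x i ≤ n i}) := by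
    rw [← preimage_iInter]
    exact preimage_mono (iInter_closure_image_boundedPrefix_subset hF n)
  have hge : ρ univ - ε ≤ ρ (⋂ k, T ⁻¹' closure (F '' {x | ∀ i < k, x i ≤ n i})) := by
    rw [hanti.measure_iInter (fun k => (hmeas k).nullMeasurableSet) ⟨0, measure_ne_top _ _⟩]
    refine le_iInf fun k => (hDlt k).le.trans (measure_mono ?_)
    rw [hDn]
    exact preimage_mono subset_closure
  calc ρ (T ⁻¹' (F '' {x | ∀ i, x i ≤ n i}))ᶜ
      ≤ ρ (⋂ k, T ⁻¹' closure (F '' {x | ∀ i < k, x i ≤ n i}))ᶜ :=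
        measure_mono (compl_subset_compl.2 hsub)
    _ = ρ univ - ρ (⋂ k, T ⁻¹' closure (F '' {x | ∀ i < k, x i ≤ n i})) :=
        measure_compl (MeasurableSet.iInter hmeas) (measure_ne_top _ _)
    _ ≤ ρ univ - (ρ univ - ε) := tsub_le_tsub_left hge _
    _ ≤ ε := tsub_tsub_le

/-- Measurable selection from the fibres of a continuous map restricted to a compact set. -/
theorem exists_measurable_selection_of_isCompact {Ω Y S : Type*} [MeasurableSpace Ω]
    [TopologicalSpace Y] [MeasurableSpace Y] [Nonempty Y]
    [TopologicalSpace S] [T2Space S] [MeasurableSpace S] [OpensMeasurableSpace S]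
    {F : Y → S} (hF : Continuous F) {φ : Y → ℝ} (hφ : Continuous φ)
    (hφm : MeasurableEmbedding φ) {K : Set Y} (hK : IsCompact K) {T : Ω → S}
    (hT : Measurable T) :
    ∃ g : Ω → Y, Measurable g ∧ ∀ ω ∈ T ⁻¹' (F '' K), F (g ω) = T ω := by
  let y₀ : Y := Classical.arbitrary Y
  have hex : ∀ ω, ∃ y, (ω ∈ T ⁻¹' (F '' K) → y ∈ K ∧ F y = T ω ∧
      ∀ y' ∈ K, F y' = T ω → φ y ≤ φ y') ∧ (ω ∉ T ⁻¹' (F '' K) → y = y₀) := by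
    intro ω
    by_cases h : ω ∈ T ⁻¹' (F '' K)
    · obtain ⟨z, hzK, hz⟩ := h
      have hc : IsCompact (K ∩ F ⁻¹' {T ω}) := hK.inter_right (isClosed_singleton.preimage hF)
      obtain ⟨y, hy, hmin⟩ := hc.exists_isMinOn ⟨z, hzK, hz⟩ hφ.continuousOn
      exact ⟨y, fun _ => ⟨hy.1, hy.2, fun y' h1 h2 => hmin ⟨h1, h2⟩⟩,
        fun h' => absurd ⟨z, hzK, hz⟩ h'⟩
    · exact ⟨y₀, fun h' => absurd h' h, fun _ => rfl⟩
  choose g hg hg₀ using hex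
  refine ⟨g, ?_, fun ω hω => (hg ω hω).2.1⟩
  rw [← hφm.measurable_comp_iff]
  refine measurable_of_Iic fun t => ?_
  have hA : MeasurableSet (T ⁻¹' (F '' K)) := hT (hK.image hF).isClosed.measurableSet
  have hAt : MeasurableSet (T ⁻¹' (F '' (K ∩ φ ⁻¹' Iic t))) :=
    hT ((hK.inter_right (isClosed_Iic.preimage hφ)).image hF).isClosed.measurableSet
  have heq : φ ∘ g ⁻¹' Iic t =
      T ⁻¹' (F '' (K ∩ φ ⁻¹' Iic t)) ∪ ((T ⁻¹' (F '' K))ᶜ ∩ {_ω | φ y₀ ≤ t}) := by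
    ext ω
    by_cases h : ω ∈ T ⁻¹' (F '' K)
    · obtain ⟨h1, h2, h3⟩ := hg ω h
      constructor
      · exact fun ht => Or.inl ⟨g ω, ⟨h1, ht⟩, h2⟩
      · rintro (⟨y, ⟨hyK, hyt⟩, hy⟩ | h')
        · exact (h3 y hyK hy).trans hyt
        · exact absurd h h'.1
    · have := hg₀ ω h
      constructor
      · intro ht
        refine Or.inr ⟨h, ?_⟩
        simpa [this] using ht
      · rintro (⟨y, ⟨hyK, hyt⟩, hy⟩ | h')
        · exact absurd ⟨y, hyK, hy⟩ h
        · simpa [this] using h'.2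
  rw [heq]
  exact hAt.union (hA.compl.inter (MeasurableSet.const _))

/-- **Measurable selection** almost everywhere: a measurable map whose values all lie in the range
of a measurable map `F` from a standard Borel space lifts measurably through `F`, up to a null
set. -/
theorem exists_measurable_ae_lift {Ω Y S : Type*} [MeasurableSpace Ω]
    [MeasurableSpace Y] [StandardBorelSpace Y] [Nonempty Y]
    [MeasurableSpace S] [StandardBorelSpace S]
    {F : Y → S} (hF : Measurable F) {T : Ω → S} (hT : Measurable T) (hTF : range T ⊆ range F)
    (ρ : Measure Ω) [IsFiniteMeasure ρ] :
    ∃ g : Ω → Y, Measurable g ∧ ∀ᵐ ω ∂ρ, F (g ω) = T ω := by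
  let := upgradeStandardBorel S
  obtain ⟨tY, hbY, hpY, hFc, hφc⟩ : ∃ t : TopologicalSpace Y, BorelSpace Y ∧ PolishSpace Y ∧
      Continuous F ∧ Continuous (embeddingReal Y) := by
    let i := upgradeStandardBorel Y
    obtain ⟨t', hle, hc, hp⟩ := (hF.prodMk (measurable_embeddingReal Y)).exists_continuous
    refine ⟨t', ?_, hp, ?_, ?_⟩
    · constructor
      rw [borel_eq_borel_of_le hp i.toPolishSpace hle]
      exact eq_borel_upgradeStandardBorel Y
    · exact (@continuous_fst S ℝ _ _).comp hc
    · exact (@continuous_snd S ℝ _ _).comp hc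
  obtain ⟨e, he, hsurj⟩ := PolishSpace.exists_nat_nat_continuous_surjective Y
  have hTe : range T ⊆ range (F ∘ e) := by rwa [hsurj.range_comp]
  have happrox : ∀ j : ℕ, ∃ A : Set Ω, MeasurableSet A ∧ ρ Aᶜ ≤ ((j : ℝ≥0∞) + 1)⁻¹ ∧
      ∃ g : Ω → Y, Measurable g ∧ ∀ ω ∈ A, F (g ω) = T ω := by
    intro j
    obtain ⟨K, hK, hle⟩ := exists_isCompact_measure_compl_preimage_image_le (hFc.comp he) hT hTe ρ
      (ε := ((j : ℝ≥0∞) + 1)⁻¹) (by simp)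
    rw [image_comp] at hle
    exact ⟨_, hT ((hK.image he).image hFc).isClosed.measurableSet, hle,
      exists_measurable_selection_of_isCompact hFc hφc (measurableEmbedding_embeddingReal Y)
        (hK.image he) hT⟩
  choose A hA hρA g hg hgA using happrox
  have hnull : ρ (⋃ j, A j)ᶜ = 0 := by
    have hle : ∀ j : ℕ, ρ (⋃ j, A j)ᶜ ≤ ((j : ℝ≥0∞) + 1)⁻¹ := fun j =>
      (measure_mono (compl_subset_compl.2 (subset_iUnion A j))).trans (hρA j)
    have hlim : Tendsto (fun j : ℕ => ((j : ℝ≥0∞) + 1)⁻¹) atTop (𝓝 0) := by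
      have := (tendsto_add_atTop_iff_nat 1).2 ENNReal.tendsto_inv_nat_nhds_zero
      simpa using this
    exact le_antisymm (ge_of_tendsto' hlim hle) zero_le
  classical
  have hcov : ∀ ω, ∃ j, ω ∈ A j ∨ ω ∈ (⋃ j, A j)ᶜ := by
    intro ω
    by_cases h : ω ∈ ⋃ j, A j
    · obtain ⟨j, hj⟩ := mem_iUnion.1 h
      exact ⟨j, Or.inl hj⟩
    · exact ⟨0, Or.inr h⟩
  refine ⟨fun ω => g (Nat.find (hcov ω)) ω, Measurable.find hg
    (p := fun j ω => ω ∈ A j ∨ ω ∈ (⋃ j, A j)ᶜ)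
    (fun j => (hA j).union (MeasurableSet.iUnion hA).compl) hcov, ?_⟩
  filter_upwards [compl_mem_ae_iff.2 hnull] with ω hω
  refine hgA _ _ ((Nat.find_spec (hcov ω)).resolve_right hω)

end MeasurableSelection

section Parametrization

open Set Filter Topology ProbabilityTheory

/-- Probability measures on a nonempty standard Borel space are measurably parametrized by a
standard Borel space. -/
theorem exists_measurable_parametrization_probabilityMeasure (E : Type*) [MeasurableSpace E]
    [StandardBorelSpace E] [Nonempty E] :
    ∃ Θ : (ℚ → ℝ) → Measure E, Measurable Θ ∧ (∀ f, IsProbabilityMeasure (Θ f)) ∧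
      ∀ m : Measure E, IsProbabilityMeasure m → ∃ f, Θ f = m := by
  have hφ := measurableEmbedding_embeddingReal E
  obtain ⟨r, hr, hrφ⟩ := hφ.exists_measurable_extend measurable_id fun _ => ‹Nonempty E›
  refine ⟨fun f => ((stieltjesOfMeasurableRat (id : (ℚ → ℝ) → ℚ → ℝ) measurable_id f).measure).map r,
    (Measure.measurable_map r hr).comp (measurable_measure_stieltjesOfMeasurableRat measurable_id),
    fun f => Measure.isProbabilityMeasure_map hr.aemeasurable, fun m hm => ?_⟩
  have : IsProbabilityMeasure (m.map (embeddingReal E)) :=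
    Measure.isProbabilityMeasure_map hφ.measurable.aemeasurable
  set F := cdf (m.map (embeddingReal E))
  have hpt : IsRatStieltjesPoint (id : (ℚ → ℝ) → ℚ → ℝ) fun q => F q :=
    { mono := fun a b hab => F.mono (by exact_mod_cast hab)
      tendsto_atTop_one := (tendsto_cdf_atTop _).comp (tendsto_ratCast_atTop_iff.2 tendsto_id)
      tendsto_atBot_zero := (tendsto_cdf_atBot _).comp (tendsto_ratCast_atBot_iff.2 tendsto_id)
      iInf_rat_gt_eq := fun t => by
        rw [id, ← F.iInf_rat_gt_eq t]
        refine Equiv.iInf_congr (Equiv.subtypeEquivRight fun r => ?_) fun r => rfl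
        exact Rat.cast_lt.symm }
  refine ⟨fun q => F q, ?_⟩
  have hm' : (stieltjesOfMeasurableRat (id : (ℚ → ℝ) → ℚ → ℝ) measurable_id fun q => F q).measure =
      m.map (embeddingReal E) := by
    rw [← measure_cdf (m.map (embeddingReal E))]
    congr 1
    ext x
    rw [← StieltjesFunction.iInf_rat_gt_eq, ← StieltjesFunction.iInf_rat_gt_eq]
    simp_rw [stieltjesOfMeasurableRat_eq, toRatCDF_of_isRatStieltjesPoint hpt]
    rfl
  simp only [hm']
  rw [Measure.map_map hr hφ.measurable, hrφ, Measure.map_id]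

/-- Probability measures on a nonempty standard Borel space are separated by countably many
measurable evaluations. -/
theorem exists_measurable_code_probabilityMeasure (E : Type*) [MeasurableSpace E]
    [StandardBorelSpace E] [Nonempty E] :
    ∃ κ : Measure E → ℚ → ℝ≥0∞, Measurable κ ∧ ∀ m m' : Measure E, IsProbabilityMeasure m →
      IsProbabilityMeasure m' → κ m = κ m' → m = m' := by
  have hφ := measurableEmbedding_embeddingReal E
  obtain ⟨r, hr, hrφ⟩ := hφ.exists_measurable_extend measurable_id fun _ => ‹Nonempty E›
  refine ⟨fun m q => m.map (embeddingReal E) (Iic (q : ℝ)), ?_, fun m m' hm hm' h => ?_⟩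
  · exact measurable_pi_lambda _ fun q =>
      (Measure.measurable_coe measurableSet_Iic).comp (Measure.measurable_map _ hφ.measurable)
  have : IsProbabilityMeasure (m.map (embeddingReal E)) :=
    Measure.isProbabilityMeasure_map hφ.measurable.aemeasurable
  have : IsProbabilityMeasure (m'.map (embeddingReal E)) :=
    Measure.isProbabilityMeasure_map hφ.measurable.aemeasurable
  have hmap : m.map (embeddingReal E) = m'.map (embeddingReal E) := by
    refine ext_of_generate_finite _ ((BorelSpace.measurable_eq (α := ℝ)).trans
      Real.borel_eq_generateFrom_Iic_rat) Real.isPiSystem_Iic_rat ?_ (by simp)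
    intro s hs
    obtain ⟨q, rfl⟩ := mem_iUnion.1 hs
    exact congrFun h q
  have h2 := congrArg (Measure.map r) hmap
  rwa [Measure.map_map hr hφ.measurable, Measure.map_map hr hφ.measurable, hrφ, Measure.map_id,
    Measure.map_id] at h2

theorem map_bind_eq_bind_of_ae_eq {Ω Λ E E' : Type*} [MeasurableSpace Ω] [MeasurableSpace Λ]
    [MeasurableSpace E] [MeasurableSpace E'] {ρ : Measure Ω} {κ : Ω → Measure E}
    (hκ : Measurable κ) {f : E → E'} (hf : Measurable f) {p : Ω → Λ} (hp : Measurable p)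
    {μ : Λ → Measure E'} (hμ : Measurable μ) (h : ∀ᵐ ω ∂ρ, (κ ω).map f = μ (p ω)) :
    (ρ.bind κ).map f = (ρ.map p).bind μ := by
  ext s hs
  rw [Measure.map_apply hf hs, Measure.bind_apply (hf hs) hκ.aemeasurable,
    Measure.bind_apply hs hμ.aemeasurable,
    lintegral_map (f := fun l => μ l s) ((Measure.measurable_coe hs).comp hμ) hp]
  refine lintegral_congr_ae ?_
  filter_upwards [h] with ω hω
  rw [← hω, Measure.map_apply hf hs]

end Parametrization

/-- The optimal transport cost between two mixtures of (measurable families of) probability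
measures is bounded by the average of the pairwise optimal transport costs:
`W_c(∫ μ_λ dP(λ), ∫ ν_{λ'} dQ(λ')) ≤ ∫∫ W_c(μ_λ, ν_{λ'}) dP(λ) dQ(λ')`. -/
theorem OTCost_bind_le
    {X Z Λ : Type*}
    [TopologicalSpace X] [PolishSpace X] [MeasurableSpace X] [BorelSpace X]
    [TopologicalSpace Z] [PolishSpace Z] [MeasurableSpace Z] [BorelSpace Z]
    [MeasurableSpace Λ]
    (c : X × Z → ℝ≥0) (hc : Measurable c)
    (P Q : Measure Λ) [IsProbabilityMeasure P] [IsProbabilityMeasure Q]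
    (μ : Λ → Measure X) (ν : Λ → Measure Z)
    (hμmeas : Measurable μ) (hνmeas : Measurable ν)
    (hμ : ∀ l, IsProbabilityMeasure (μ l)) (hν : ∀ l, IsProbabilityMeasure (ν l))
    (hW : Measurable fun p : Λ × Λ => OTCost c (μ p.1) (ν p.2)) :
    OTCost c (P.bind μ) (Q.bind ν) ≤
      ∫⁻ l, ∫⁻ l', OTCost c (μ l) (ν l') ∂Q ∂P := by
  obtain ⟨l₀⟩ : Nonempty Λ := P.nonempty_of_neZero
  have : Nonempty X := (μ l₀).nonempty_of_neZero
  have : Nonempty Z := (ν l₀).nonempty_of_neZero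
  obtain ⟨Θ, hΘ, hΘp, hΘsurj⟩ := exists_measurable_parametrization_probabilityMeasure (X × Z)
  obtain ⟨κX, hκX, hκXinj⟩ := exists_measurable_code_probabilityMeasure X
  obtain ⟨κZ, hκZ, hκZinj⟩ := exists_measurable_code_probabilityMeasure Z
  have hc' : Measurable fun p => (c p : ℝ≥0∞) := hc.coe_nnreal_ennreal
  rw [← lintegral_prod (μ := P) (ν := Q) (fun p : Λ × Λ => OTCost c (μ p.1) (ν p.2))
    hW.aemeasurable]
  refine ENNReal.le_of_forall_pos_le_add fun ε hε _ => ?_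
  have hcost : Measurable fun f => ∫⁻ p, (c p : ℝ≥0∞) ∂(Θ f) :=
    (Measure.measurable_lintegral hc').comp hΘ
  let B : Set ((ℚ → ℝ) × ℝ≥0∞) := {y | ∫⁻ p, (c p : ℝ≥0∞) ∂(Θ y.1) ≤ y.2 + ε}
  have hB : MeasurableSet B :=
    measurableSet_le (hcost.comp measurable_fst) (measurable_snd.add_const _)
  have : StandardBorelSpace B := hB.standardBorel
  let F : B → (ℚ → ℝ≥0∞) × (ℚ → ℝ≥0∞) × ℝ≥0∞ := fun y =>
    (κX ((Θ y.1.1).map Prod.fst), κZ ((Θ y.1.1).map Prod.snd), y.1.2)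
  have hΘB : Measurable fun y : B => Θ y.1.1 :=
    hΘ.comp (measurable_fst.comp measurable_subtype_coe)
  have hF : Measurable F :=
    (hκX.comp ((Measure.measurable_map _ measurable_fst).comp hΘB)).prodMk
      ((hκZ.comp ((Measure.measurable_map _ measurable_snd).comp hΘB)).prodMk
        (measurable_snd.comp measurable_subtype_coe))
  let T : Λ × Λ → (ℚ → ℝ≥0∞) × (ℚ → ℝ≥0∞) × ℝ≥0∞ := fun p =>
    (κX (μ p.1), κZ (ν p.2), OTCost c (μ p.1) (ν p.2))
  have hT : Measurable T :=
    (hκX.comp (hμmeas.comp measurable_fst)).prodMk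
      ((hκZ.comp (hνmeas.comp measurable_snd)).prodMk hW)
  have hTF : ∀ p, ∃ y, F y = T p := by
    intro p
    obtain ⟨π, hπ, ⟨hπ₁, hπ₂⟩, hle⟩ : ∃ π : Measure (X × Z), IsProbabilityMeasure π ∧
        IsCoupling π (μ p.1) (ν p.2) ∧
        ∫⁻ q, (c q : ℝ≥0∞) ∂π ≤ OTCost c (μ p.1) (ν p.2) + ε := by
      rcases eq_or_ne (OTCost c (μ p.1) (ν p.2)) ∞ with htop | htop
      · refine ⟨(μ p.1).prod (ν p.2), inferInstance, ⟨?_, ?_⟩, by simp [htop]⟩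
        · simp [Measure.map_fst_prod]
        · simp [Measure.map_snd_prod]
      · have hlt : OTCost c (μ p.1) (ν p.2) < OTCost c (μ p.1) (ν p.2) + ε :=
          ENNReal.lt_add_right htop (by exact_mod_cast hε.ne')
        nth_rewrite 1 [OTCost] at hlt
        simp only [iInf_lt_iff] at hlt
        obtain ⟨π, hπ, hlt⟩ := hlt
        exact ⟨π, hπ.1, hπ.2, hlt.le⟩
    obtain ⟨f, hf⟩ := hΘsurj π hπ
    exact ⟨⟨(f, OTCost c (μ p.1) (ν p.2)), by simpa [B, hf] using hle⟩,
      by simp [F, T, hf, hπ₁, hπ₂]⟩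
  have : Nonempty B := ⟨(hTF (l₀, l₀)).choose⟩
  obtain ⟨g, hg, hgT⟩ := exists_measurable_ae_lift hF hT
    (Set.range_subset_iff.2 hTF) (P.prod Q)
  let κ : Λ × Λ → Measure (X × Z) := fun p => Θ (g p).1.1
  have hκ : Measurable κ := hΘB.comp hg
  have hfst : ∀ᵐ p ∂P.prod Q, (κ p).map Prod.fst = μ p.1 := by
    filter_upwards [hgT] with p hp
    exact hκXinj _ _ (Measure.isProbabilityMeasure_map measurable_fst.aemeasurable) (hμ _)
      (congrArg (fun s => s.1) hp)
  have hsnd : ∀ᵐ p ∂P.prod Q, (κ p).map Prod.snd = ν p.2 := by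
    filter_upwards [hgT] with p hp
    exact hκZinj _ _ (Measure.isProbabilityMeasure_map measurable_snd.aemeasurable) (hν _)
      (congrArg (fun s => s.2.1) hp)
  have hle : ∀ᵐ p ∂P.prod Q, ∫⁻ q, (c q : ℝ≥0∞) ∂(κ p) ≤ OTCost c (μ p.1) (ν p.2) + ε := by
    filter_upwards [hgT] with p hp
    have h2 : (g p).1.2 = OTCost c (μ p.1) (ν p.2) := congrArg (fun s => s.2.2) hp
    rw [← h2]
    exact (g p).2
  have hprob : IsProbabilityMeasure ((P.prod Q).bind κ) := by
    constructor
    rw [Measure.bind_apply MeasurableSet.univ hκ.aemeasurable]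
    simp [κ]
  have hcoupling : IsCoupling ((P.prod Q).bind κ) (P.bind μ) (Q.bind ν) := by
    constructor
    · rw [map_bind_eq_bind_of_ae_eq hκ measurable_fst measurable_fst hμmeas hfst]
      simp [Measure.map_fst_prod]
    · rw [map_bind_eq_bind_of_ae_eq hκ measurable_snd measurable_snd hνmeas hsnd]
      simp [Measure.map_snd_prod]
  calc OTCost c (P.bind μ) (Q.bind ν)
      ≤ ∫⁻ q, (c q : ℝ≥0∞) ∂((P.prod Q).bind κ) := iInf₂_le _ ⟨hprob, hcoupling⟩
    _ = ∫⁻ p, ∫⁻ q, (c q : ℝ≥0∞) ∂(κ p) ∂P.prod Q :=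
        Measure.lintegral_bind hκ.aemeasurable hc'.aemeasurable
    _ ≤ ∫⁻ p, (OTCost c (μ p.1) (ν p.2) + ε) ∂P.prod Q := lintegral_mono_ae hle
    _ = ∫⁻ p, OTCost c (μ p.1) (ν p.2) ∂P.prod Q + ε := by
        rw [lintegral_add_right _ measurable_const]
        simp
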